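/- arXiv:2410.06103 — 2 statements merged into one kernel-verified Lean document; each statement's English description precedes it below -/
import Mathlib

section
/- The resulting map Cl(p+1,q+1) → M₂(Cl(p,q)), sending A₀₀ + e A₀₁ + ẽ A₁₀ + ẽe A₁₁ to [[A₀₀+A₁₁, α(A₀₁+A₁₀)], [A₀₁−A₁₀, α(A₀₀−A₁₁)]], is an algebra isomorphism. -/
open CliffordAlgebra

theorem stmt9_spans {K V : Type*} [Field K] [AddCommGroup V] [Module K V]
    (Q : QuadraticForm K V)
    (Q' : QuadraticForm K (V × (K × K)))
    (hQ' : Q' = Q.prod (QuadraticMap.sq.prod (-QuadraticMap.sq)))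
    (j : CliffordAlgebra Q →ₐ[K] CliffordAlgebra Q')
    (hj : ∀ v : V, j (ι Q v) = ι Q' (v, 0))
    (E T : CliffordAlgebra Q')
    (hE : E = ι Q' (0, (1, 0))) (hT : T = ι Q' (0, (0, 1)))
    (x : CliffordAlgebra Q') :
    ∃ A B C D : CliffordAlgebra Q, x = j A + E * j B + T * j C + T * E * j D := by
  have hEE : E * E = 1 := by
    rw [hE, ι_sq_scalar, hQ']; simp
  have hTT : T * T = -1 := by
    rw [hT, ι_sq_scalar, hQ']; simp
  have hET : E * T = -(T * E) := by
    rw [eq_neg_iff_add_eq_zero, hE, hT, ι_mul_ι_add_swap, hQ']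
    simp [QuadraticMap.polar]
  have hvE (v : V) : j (ι Q v) * E = -(E * j (ι Q v)) := by
    rw [eq_neg_iff_add_eq_zero, hj, hE, ι_mul_ι_add_swap, hQ']
    simp [QuadraticMap.polar]
  have hvT (v : V) : j (ι Q v) * T = -(T * j (ι Q v)) := by
    rw [eq_neg_iff_add_eq_zero, hj, hT, ι_mul_ι_add_swap, hQ']
    simp [QuadraticMap.polar]
  have hdec (v : V) (a b : K) : ι Q' (v, (a, b)) = j (ι Q v) + a • E + b • T := by
    rw [hj, hE, hT, ← map_smul, ← map_smul, ← map_add, ← map_add]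
    simp
  induction x using CliffordAlgebra.left_induction with
  | algebraMap r => exact ⟨algebraMap K _ r, 0, 0, 0, by simp⟩
  | add x y hx hy =>
    obtain ⟨A, B, C, D, rfl⟩ := hx
    obtain ⟨A', B', C', D', rfl⟩ := hy
    exact ⟨A + A', B + B', C + C', D + D', by simp only [map_add, mul_add]; abel⟩
  | ι_mul x m hx =>
    obtain ⟨A, B, C, D, rfl⟩ := hx
    obtain ⟨v, a, b⟩ := m
    refine ⟨ι Q v * A + a • B - b • C, -(ι Q v * B) + a • A - b • D,
      -(ι Q v * C) - a • D + b • A, ι Q v * D - a • C + b • B, ?_⟩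
    rw [hdec]
    have hEE' (y) : E * (E * y) = y := by rw [← mul_assoc, hEE, one_mul]
    have hTT' (y) : T * (T * y) = -y := by rw [← mul_assoc, hTT, neg_one_mul]
    have hET' (y) : E * (T * y) = -(T * (E * y)) := by
      rw [← mul_assoc, hET, neg_mul, mul_assoc]
    have hvE' (y) : j (ι Q v) * (E * y) = -(E * (j (ι Q v) * y)) := by
      rw [← mul_assoc, hvE, neg_mul, mul_assoc]
    have hvT' (y) : j (ι Q v) * (T * y) = -(T * (j (ι Q v) * y)) := by
      rw [← mul_assoc, hvT, neg_mul, mul_assoc]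
    simp only [map_add, map_sub, map_neg, map_mul, map_smul, mul_add, add_mul, mul_sub,
      smul_mul_assoc, mul_smul_comm, mul_assoc, mul_neg, neg_neg, smul_neg, hEE', hTT', hET',
      hvE', hvT']
    abel

set_option maxHeartbeats 2000000 in
theorem stmt9 {K V : Type*} [Field K] [AddCommGroup V] [Module K V]
    (hK : (2 : K) ≠ 0) (Q : QuadraticForm K V)
    (Q' : QuadraticForm K (V × (K × K)))
    (hQ' : Q' = Q.prod (QuadraticMap.sq.prod (-QuadraticMap.sq)))
    (j : CliffordAlgebra Q →ₐ[K] CliffordAlgebra Q')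
    (hj : ∀ v : V, j (ι Q v) = ι Q' (v, 0))
    (E T : CliffordAlgebra Q')
    (hE : E = ι Q' (0, (1, 0))) (hT : T = ι Q' (0, (0, 1))) :
    ∃ φ : CliffordAlgebra Q' ≃ₐ[K] Matrix (Fin 2) (Fin 2) (CliffordAlgebra Q),
      ∀ A00 A01 A10 A11 : CliffordAlgebra Q,
        φ (j A00 + E * j A01 + T * j A10 + T * E * j A11) =
          !![A00 + A11, involute (A01 + A10);
             A01 - A10, involute (A00 - A11)] := by
  let f : V × (K × K) →ₗ[K] Matrix (Fin 2) (Fin 2) (CliffordAlgebra Q) :=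
    { toFun := fun m => !![ι Q m.1, algebraMap K _ (m.2.1 + m.2.2);
        algebraMap K _ (m.2.1 - m.2.2), -ι Q m.1]
      map_add' := by
        intro x y
        ext i k
        fin_cases i <;> fin_cases k <;> simp <;> abel
      map_smul' := by
        intro c x
        ext i k
        fin_cases i <;> fin_cases k <;> simp [Algebra.smul_def, mul_add, mul_sub] }
  have hf (m) : f m * f m = algebraMap K _ (Q' m) := by
    obtain ⟨v, a, b⟩ := m
    ext i k
    fin_cases i <;> fin_cases k <;>
      simp only [f, LinearMap.coe_mk, AddHom.coe_mk, hQ', Matrix.algebraMap_matrix_apply,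
        Matrix.mul_apply, Fin.sum_univ_two]
    · simp [-map_add, -map_sub, ← map_mul, ← map_add]
      ring_nf
    · simp [-map_add, -map_sub, Algebra.commutes]
    · simp [-map_add, -map_sub, Algebra.commutes]
    · simp [-map_add, -map_sub, ← map_mul, ← map_add]
      ring_nf
  let F : CliffordAlgebra Q' →ₐ[K] Matrix (Fin 2) (Fin 2) (CliffordAlgebra Q) :=
    CliffordAlgebra.lift Q' ⟨f, hf⟩
  have hFι (m) : F (ι Q' m) = f m := by simp [F]
  have hFj (A) : F (j A) = !![A, 0; 0, involute A] := by
    induction A using CliffordAlgebra.induction with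
    | algebraMap r =>
      rw [AlgHom.commutes, AlgHom.commutes, AlgHom.commutes]
      ext i k
      fin_cases i <;> fin_cases k <;> simp [Matrix.algebraMap_matrix_apply]
    | ι v => rw [hj, hFι]; simp [f]
    | mul a b ha hb => rw [map_mul, map_mul, ha, hb]; simp
    | add a b ha hb => rw [map_add, map_add, ha, hb]; simp
  clear_value F
  have hFE : F E = !![0, 1; 1, 0] := by rw [hE, hFι]; simp [f]
  have hFT : F T = !![0, 1; -1, 0] := by rw [hT, hFι]; simp [f]
  have key (A B C D : CliffordAlgebra Q) : F (j A + E * j B + T * j C + T * E * j D) =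
      !![A + D, involute (B + C); B - C, involute (A - D)] := by
    rw [map_add, map_add, map_add, map_mul, map_mul, map_mul, map_mul, hFj, hFj, hFj, hFj,
      hFE, hFT]
    simp [sub_eq_add_neg]
  have h2 (x y : CliffordAlgebra Q) (h : x + y = 0) (h' : x - y = 0) : x = 0 ∧ y = 0 := by
    have hxy : x = y := sub_eq_zero.1 h'
    subst hxy
    rw [← two_smul K] at h
    have := (smul_eq_zero.1 h).resolve_left hK
    exact ⟨this, this⟩
  have hhalf (x : CliffordAlgebra Q) : (2 : K)⁻¹ • x + (2 : K)⁻¹ • x = x := by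
    rw [← add_smul, ← two_mul, mul_inv_cancel₀ hK, one_smul]
  have hinj : Function.Injective F := by
    rw [injective_iff_map_eq_zero]
    intro x hx
    obtain ⟨A, B, C, D, rfl⟩ := stmt9_spans Q Q' hQ' j hj E T hE hT x
    rw [key] at hx
    have e00 := congrFun (congrFun hx 0) 0
    have e01 := congrArg involute (congrFun (congrFun hx 0) 1)
    have e10 := congrFun (congrFun hx 1) 0
    have e11 := congrArg involute (congrFun (congrFun hx 1) 1)
    simp only [Matrix.of_apply, Matrix.cons_val', Matrix.cons_val_zero, Matrix.cons_val_one,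
      Matrix.zero_apply, involute_involute, map_zero, Matrix.cons_val_fin_one] at e00 e01 e10 e11
    obtain ⟨rfl, rfl⟩ := h2 _ _ e00 e11
    obtain ⟨rfl, rfl⟩ := h2 _ _ e01 e10
    simp
  have hsurj : Function.Surjective F := by
    intro M
    have hh (x y : CliffordAlgebra Q) :
        (2 : K)⁻¹ • (x + y) + (2 : K)⁻¹ • (x - y) = x := by
      rw [← smul_add, add_add_sub_cancel, smul_add, hhalf]
    have hh' (x y : CliffordAlgebra Q) :
        (2 : K)⁻¹ • (x + y) - (2 : K)⁻¹ • (x - y) = y := by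
      rw [← smul_sub, add_sub_sub_cancel, smul_add, hhalf]
    refine ⟨j ((2 : K)⁻¹ • (M 0 0 + involute (M 1 1))) +
      E * j ((2 : K)⁻¹ • (involute (M 0 1) + M 1 0)) +
      T * j ((2 : K)⁻¹ • (involute (M 0 1) - M 1 0)) +
      T * E * j ((2 : K)⁻¹ • (M 0 0 - involute (M 1 1))), ?_⟩
    rw [key, hh, hh, hh', hh', involute_involute, involute_involute]
    exact (Matrix.eta_fin_two M).symm
  exact ⟨AlgEquiv.ofBijective F ⟨hinj, hsurj⟩, key⟩
end

section
/- Cl(n,n) over a field K of characteristic ≠ 2 is isomorphic as a K-algebra to the algebra of 2ⁿ × 2ⁿ matrices over K. -/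
section Aux

set_option linter.all false

variable {K : Type*} [Field K]

/-- the hyperbolic plane `x² - y²` -/
noncomputable def hypQ (K : Type*) [Field K] : QuadraticForm K (K × K) :=
  (QuadraticMap.sq (R := K)).prod (-(QuadraticMap.sq (R := K)))

theorem hypQ_apply (p : K × K) : hypQ K p = p.1 * p.1 - p.2 * p.2 := by
  simp [hypQ, sub_eq_add_neg]

variable {V : Type*} [AddCommGroup V] [Module K V] (Q : QuadraticForm K V)

open CliffordAlgebra Matrix

/-- generator part of the forward map -/
noncomputable def fwdLin : V × (K × K) →ₗ[K] Matrix (Fin 2) (Fin 2) (CliffordAlgebra Q) where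
  toFun p := !![ι Q p.1, algebraMap K _ (p.2.1 + p.2.2); algebraMap K _ (p.2.1 - p.2.2), - ι Q p.1]
  map_add' p q := by
    ext i j; fin_cases i <;> fin_cases j <;> simp <;> abel
  map_smul' c p := by
    ext i j; fin_cases i <;> fin_cases j <;> simp [Algebra.smul_def, mul_add, mul_sub]

noncomputable def fwd : CliffordAlgebra (Q.prod (hypQ K)) →ₐ[K]
    Matrix (Fin 2) (Fin 2) (CliffordAlgebra Q) :=
  CliffordAlgebra.lift _ ⟨fwdLin Q, by
    rintro ⟨v, x, y⟩
    have h1 : ∀ c : K, ι Q v * algebraMap K _ c = algebraMap K _ c * ι Q v :=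
      fun c => (Algebra.commutes c _).symm
    have e : algebraMap K (Matrix (Fin 2) (Fin 2) (CliffordAlgebra Q))
        ((Q.prod (hypQ K)) (v, x, y)) =
        !![algebraMap K _ (Q v + (x * x - y * y)), 0; 0,
          algebraMap K _ (Q v + (x * x - y * y))] := by
      ext i j; fin_cases i <;> fin_cases j <;>
        simp [Matrix.algebraMap_matrix_apply, hypQ_apply]
    rw [e]
    ext i j; fin_cases i <;> fin_cases j
    · simp only [fwdLin, LinearMap.coe_mk, AddHom.coe_mk]
      simp [Matrix.mul_apply, -map_add, -map_sub, ι_sq_scalar, ← map_mul, ← map_add]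
      congr 1; ring
    · simp only [fwdLin, LinearMap.coe_mk, AddHom.coe_mk]
      simp [Matrix.mul_apply, -map_add, -map_sub, h1]
    · simp only [fwdLin, LinearMap.coe_mk, AddHom.coe_mk]
      simp [Matrix.mul_apply, -map_add, -map_sub, h1]
    · simp only [fwdLin, LinearMap.coe_mk, AddHom.coe_mk]
      simp [Matrix.mul_apply, -map_add, -map_sub, ι_sq_scalar, ← map_mul, ← map_add]
      congr 1; ring⟩

theorem fwd_ι (p) : fwd Q (ι _ p) =
   !![ι Q p.1, algebraMap K _ (p.2.1 + p.2.2); algebraMap K _ (p.2.1 - p.2.2), - ι Q p.1] := by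
  simp [fwd, fwdLin]

noncomputable def gE : CliffordAlgebra (Q.prod (hypQ K)) := ι _ (0, 1, 0)
noncomputable def gF : CliffordAlgebra (Q.prod (hypQ K)) := ι _ (0, 0, 1)

theorem gE_sq : gE Q * gE Q = 1 := by
  simp [gE, ι_sq_scalar, hypQ_apply]

theorem gF_sq : gF Q * gF Q = -1 := by
  simp [gF, ι_sq_scalar, hypQ_apply]

theorem gFE : gF Q * gE Q = -(gE Q * gF Q) := by
  rw [eq_neg_iff_add_eq_zero]
  simp [gF, gE, ι_mul_ι_add_swap, QuadraticMap.polar, hypQ_apply]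

theorem gE_v (v : V) : gE Q * ι _ (v, 0, 0) = -(ι _ (v, 0, 0) * gE Q) := by
  rw [eq_neg_iff_add_eq_zero]
  simp [gE, ι_mul_ι_add_swap, QuadraticMap.polar, hypQ_apply]

theorem gF_v (v : V) : gF Q * ι _ (v, 0, 0) = -(ι _ (v, 0, 0) * gF Q) := by
  rw [eq_neg_iff_add_eq_zero]
  simp [gF, ι_mul_ι_add_swap, QuadraticMap.polar, hypQ_apply]

theorem EE_mul (x) : gE Q * (gE Q * x) = x := by rw [← mul_assoc, gE_sq, one_mul]
theorem FF_mul (x) : gF Q * (gF Q * x) = -x := by rw [← mul_assoc, gF_sq, neg_one_mul]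
theorem FE_mul (x) : gF Q * (gE Q * x) = -(gE Q * (gF Q * x)) := by
  rw [← mul_assoc, gFE, neg_mul, mul_assoc]
theorem gE_v_mul (v : V) (x) : gE Q * (ι _ (v, 0, 0) * x) = -(ι _ (v, 0, 0) * (gE Q * x)) := by
  rw [← mul_assoc, gE_v, neg_mul, mul_assoc]
theorem gF_v_mul (v : V) (x) : gF Q * (ι _ (v, 0, 0) * x) = -(ι _ (v, 0, 0) * (gF Q * x)) := by
  rw [← mul_assoc, gF_v, neg_mul, mul_assoc]

/-- embedding of `Cl(Q)` commuting with the matrix units -/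
noncomputable def emb : CliffordAlgebra Q →ₐ[K] CliffordAlgebra (Q.prod (hypQ K)) :=
  CliffordAlgebra.lift Q
    ⟨(LinearMap.mulRight K (gF Q * gE Q)) ∘ₗ (ι (Q.prod (hypQ K))) ∘ₗ LinearMap.inl K V (K × K), by
      intro v
      have : ι (Q.prod (hypQ K)) (v, 0, 0) * ι (Q.prod (hypQ K)) (v, 0, 0) = algebraMap K _ (Q v) := by
        simp [ι_sq_scalar, hypQ_apply]
      have h0 : ((0 : K × K)) = (0, 0) := rfl
      simp only [LinearMap.comp_apply, LinearMap.inl_apply, LinearMap.mulRight_apply, h0]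
      rw [← this]
      simp only [mul_assoc, gE_v_mul, gF_v_mul, EE_mul, FF_mul, FE_mul, gE_sq, gF_sq, gFE,
        mul_neg, neg_mul, neg_neg, mul_one]⟩

theorem emb_ι (v : V) : emb Q (ι Q v) = ι _ (v, 0, 0) * (gF Q * gE Q) := by
  simp [emb, mul_assoc]; rfl

theorem emb_E (a) : gE Q * emb Q a = emb Q a * gE Q := by
  induction a using CliffordAlgebra.induction with
  | algebraMap r => simp [Algebra.commutes]
  | ι v =>
    simp only [emb_ι, mul_assoc, gE_v_mul, gF_v_mul, EE_mul, FF_mul, FE_mul, gE_sq, gF_sq, gFE,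
        mul_neg, neg_mul, neg_neg, mul_one]
  | mul a b ha hb => rw [map_mul, ← mul_assoc, ha, mul_assoc, hb, mul_assoc]
  | add a b ha hb => rw [map_add, mul_add, ha, hb, add_mul]

theorem emb_F (a) : gF Q * emb Q a = emb Q a * gF Q := by
  induction a using CliffordAlgebra.induction with
  | algebraMap r => simp [Algebra.commutes]
  | ι v =>
    simp only [emb_ι, mul_assoc, gE_v_mul, gF_v_mul, EE_mul, FF_mul, FE_mul, gE_sq, gF_sq, gFE,
        mul_neg, neg_mul, neg_neg, mul_one]
  | mul a b ha hb => rw [map_mul, ← mul_assoc, ha, mul_assoc, hb, mul_assoc]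
  | add a b ha hb => rw [map_add, mul_add, ha, hb, add_mul]

theorem emb_E_mul (a x) : gE Q * (emb Q a * x) = emb Q a * (gE Q * x) := by
  rw [← mul_assoc, emb_E, mul_assoc]
theorem emb_F_mul (a x) : gF Q * (emb Q a * x) = emb Q a * (gF Q * x) := by
  rw [← mul_assoc, emb_F, mul_assoc]

/-- twice the inverse map -/
noncomputable def bwd (M : Matrix (Fin 2) (Fin 2) (CliffordAlgebra Q)) :
    CliffordAlgebra (Q.prod (hypQ K)) :=
  emb Q (M 0 0) * (1 + gF Q * gE Q) + emb Q (M 0 1) * (gE Q + gF Q) +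
  emb Q (M 1 0) * (gE Q - gF Q) + emb Q (M 1 1) * (1 - gF Q * gE Q)

theorem bwd_add (M N) : bwd Q (M + N) = bwd Q M + bwd Q N := by
  simp only [bwd, Matrix.add_apply, map_add, add_mul]; abel

theorem bwd_one : bwd Q 1 = 2 := by
  simp [bwd]; norm_num

theorem ι_split (v : V) (x y : K) : ι (Q.prod (hypQ K)) (v, x, y) =
    emb Q (ι Q v) * (gF Q * gE Q) + x • gE Q + y • gF Q := by
  have h : ((v, x, y) : V × K × K) = (v, 0, 0) + x • (0, 1, 0) + y • (0, 0, 1) := by simp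
  rw [h, map_add, map_add, map_smul, map_smul]
  congr 2
  simp only [emb_ι, mul_assoc, gE_v_mul, gF_v_mul, EE_mul, FF_mul, FE_mul, gE_sq, gF_sq, gFE,
        mul_neg, neg_mul, neg_neg, mul_one]

theorem bwd_fwd_mul (x) : ∀ M, bwd Q (fwd Q x * M) = x * bwd Q M := by
  induction x using CliffordAlgebra.induction with
  | algebraMap r =>
    intro M
    rw [AlgHom.commutes, ← Algebra.smul_def, ← Algebra.smul_def]
    simp [bwd, smul_add]
  | ι p =>
    obtain ⟨v, x, y⟩ := p
    intro M
    rw [fwd_ι, ι_split]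
    simp only [bwd, Matrix.mul_apply, Fin.sum_univ_two]
    simp [add_mul, mul_add, mul_sub, sub_mul, mul_assoc, emb_E_mul, emb_F_mul, EE_mul, FF_mul, FE_mul, gE_sq, gF_sq, gFE, emb_E, emb_F, ← Algebra.smul_def]
    module
  | mul a b ha hb => intro M; rw [map_mul, mul_assoc, ha, hb, mul_assoc]
  | add a b ha hb => intro M; rw [map_add, add_mul, bwd_add, ha, hb, add_mul]

theorem fwd_inj (hK : (2 : K) ≠ 0) : Function.Injective (fwd Q) := by
  rw [injective_iff_map_eq_zero]
  intro x hx
  have h := bwd_fwd_mul Q x 1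
  rw [hx, zero_mul, bwd_one] at h
  have h0 : bwd Q 0 = 0 := by simp [bwd]
  rw [h0] at h
  have h2 : (2 : K) • x = 0 := by
    rw [two_smul, ← mul_two]; exact h.symm
  exact (smul_eq_zero.1 h2).resolve_left hK

theorem fwd_E : fwd Q (gE Q) = !![0, 1; 1, 0] := by simp [gE, fwd_ι]
theorem fwd_F : fwd Q (gF Q) = !![0, 1; -1, 0] := by simp [gF, fwd_ι]

theorem fwd_emb (a) : fwd Q (emb Q a) = !![a, 0; 0, a] := by
  induction a using CliffordAlgebra.induction with
  | algebraMap r =>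
    rw [AlgHom.commutes, AlgHom.commutes]
    ext i j; fin_cases i <;> fin_cases j <;> simp [Matrix.algebraMap_matrix_apply]
  | ι v => simp [emb_ι, fwd_E, fwd_F, fwd_ι]
  | mul a b ha hb => simp [ha, hb]
  | add a b ha hb => simp [ha, hb]

theorem fwd_bwd (M) : fwd Q (bwd Q M) = (2 : K) • M := by
  simp only [bwd, map_add, map_mul, map_sub, fwd_emb, fwd_E, fwd_F, map_one, Matrix.one_fin_two]
  ext i j; fin_cases i <;> fin_cases j <;> simp <;> simp [two_smul, mul_add, mul_sub]

theorem fwd_surj (hK : (2 : K) ≠ 0) : Function.Surjective (fwd Q) := by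
  intro M
  refine ⟨(2 : K)⁻¹ • bwd Q M, ?_⟩
  rw [map_smul, fwd_bwd, smul_smul, inv_mul_cancel₀ hK, one_smul]

noncomputable def fwdEquiv (hK : (2 : K) ≠ 0) : CliffordAlgebra (Q.prod (hypQ K)) ≃ₐ[K]
    Matrix (Fin 2) (Fin 2) (CliffordAlgebra Q) :=
  AlgEquiv.ofBijective (fwd Q) ⟨fwd_inj Q hK, fwd_surj Q hK⟩

/-- the form of signature `(n,n)` -/
noncomputable abbrev nnQ (K : Type*) [Field K] (n : ℕ) :=
  ((QuadraticMap.weightedSumSquares K (fun _ : Fin n => (1 : K))).prod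
            (QuadraticMap.weightedSumSquares K (fun _ : Fin n => (-1 : K))))

noncomputable def succIso (n : ℕ) : (nnQ K (n + 1)).IsometryEquiv ((nnQ K n).prod (hypQ K)) where
  toFun p := ((fun i => p.1 i.succ, fun i => p.2 i.succ), (p.1 0, p.2 0))
  invFun q := (Fin.cons q.2.1 q.1.1, Fin.cons q.2.2 q.1.2)
  map_add' p q := rfl
  map_smul' c p := rfl
  left_inv p := by
    ext i <;> refine Fin.cases ?_ (fun i => ?_) i <;> simp
  right_inv q := by simp
  map_app' p := by
    simp [hypQ_apply, QuadraticMap.weightedSumSquares_apply, Fin.sum_univ_succ]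
    ring

theorem ofId_bij :
    Function.Bijective (Algebra.ofId K (Matrix (Fin (2 ^ 0)) (Fin (2 ^ 0)) K)) := by
  have hs : ∀ i : Fin (2 ^ 0), i = ⟨0, by simp⟩ := fun i => by ext; have := i.2; simp at this ⊢
  constructor
  · intro a b h
    have := congrFun (congrFun h ⟨0, by simp⟩) ⟨0, by simp⟩
    simpa [Algebra.ofId_apply, Matrix.algebraMap_matrix_apply] using this
  · intro M
    refine ⟨M ⟨0, by simp⟩ ⟨0, by simp⟩, ?_⟩
    ext i j
    rw [hs i, hs j]
    simp [Algebra.ofId_apply, Matrix.algebraMap_matrix_apply]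

end Aux

/-- `Cl(n,n)` over a field `K` of characteristic ≠ 2 is
isomorphic as a `K`-algebra to the algebra of `2ⁿ × 2ⁿ` matrices over `K`.
`Cl(n,n)` is modelled as the Clifford algebra of the quadratic form
`∑ xᵢ² − ∑ yᵢ²` on `(Fin n → K) × (Fin n → K)`. -/
theorem stmt10 {K : Type*} [Field K] (hK : (2 : K) ≠ 0) (n : ℕ) :
    Nonempty
      (CliffordAlgebra
          ((QuadraticMap.weightedSumSquares K (fun _ : Fin n => (1 : K))).prod
            (QuadraticMap.weightedSumSquares K (fun _ : Fin n => (-1 : K)))) ≃ₐ[K]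
        Matrix (Fin (2 ^ n)) (Fin (2 ^ n)) K) := by
  induction n with
  | zero =>
    let i : (nnQ K 0).IsometryEquiv (0 : QuadraticForm K Unit) :=
      { toFun := fun _ => (), invFun := fun _ => 0, map_add' := fun _ _ => rfl,
        map_smul' := fun _ _ => rfl, left_inv := fun _ => Subsingleton.elim _ _,
        right_inv := fun _ => rfl,
        map_app' := fun m => by simp [QuadraticMap.weightedSumSquares_apply] }
    exact ⟨((CliffordAlgebra.equivOfIsometry i).trans CliffordAlgebraRing.equiv).trans
      (AlgEquiv.ofBijective (Algebra.ofId K (Matrix (Fin (2 ^ 0)) (Fin (2 ^ 0)) K)) ofId_bij)⟩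
  | succ n ih =>
    obtain ⟨f⟩ := ih
    exact ⟨(((CliffordAlgebra.equivOfIsometry (succIso n)).trans (fwdEquiv _ hK)).trans
      f.mapMatrix).trans ((Matrix.compAlgEquiv _ _ _ _).trans
        (Matrix.reindexAlgEquiv K K (finProdFinEquiv.trans (finCongr (by ring)))))⟩
end
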